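/- Let C be a Clifford unitary on n qubits and P ∈ 𝒫ₙ an arbitrary Pauli operator. Then ρ(C† P C) = ρ(P) ⊛ F(C), i.e. the flow-tableau vector–matrix product of the presentation of P with the flow tableau of C computes the presentation of the pullback of P through C. -/

import Mathlib

open Matrix

abbrev GG (n : ℕ) := ZMod 4 × (Fin n → ZMod 2) × (Fin n → ZMod 2)

def dotF2 {n : ℕ} (a b : Fin n → ZMod 2) : ZMod 2 := ∑ j, a j * b j

def lift24 (x : ZMod 2) : ZMod 4 := (x.val : ZMod 4)

def gop {n : ℕ} (p q : GG n) : GG n :=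
  (p.1 + q.1 + 2 * lift24 (dotF2 p.2.2 q.2.1), p.2.1 + q.2.1, p.2.2 + q.2.2)

abbrev PMat (n : ℕ) := Matrix (Fin n → ZMod 2) (Fin n → ZMod 2) ℂ

noncomputable def PauliOp {n : ℕ} (ε : ZMod 4) (ξ ζ : Fin n → ZMod 2) : PMat n :=
  fun u v => Complex.I ^ ε.val * (-1 : ℂ) ^ (dotF2 ζ v).val * (if u = v + ξ then 1 else 0)

def eVec {n : ℕ} (t : Fin n) : Fin n → ZMod 2 := fun j => if j = t then 1 else 0

/-- A Clifford unitary: a unitary matrix normalizing the Pauli group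
(under right conjugation C† P C). -/
def IsCliffordUnitary {n : ℕ} (C : PMat n) : Prop :=
  C * Cᴴ = 1 ∧ Cᴴ * C = 1 ∧
  ∀ p : GG n, ∃ q : GG n, Cᴴ * PauliOp p.1 p.2.1 p.2.2 * C = PauliOp q.1 q.2.1 q.2.2

/-- The generators g₀ = iI, g_j = P(0,e_j,0) (1 ≤ j ≤ n), g_{n+j} = P(0,0,e_j). -/
noncomputable def gens (n : ℕ) (i : Fin (2 * n + 1)) : PMat n :=
  if _h0 : i.val = 0 then Complex.I • (1 : PMat n)
  else if h1 : i.val ≤ n then PauliOp 0 (eVec ⟨i.val - 1, by have := i.isLt; omega⟩) 0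
  else PauliOp 0 0 (eVec ⟨i.val - 1 - n, by have := i.isLt; omega⟩)

/-- M is the flow tableau of C: row i presents C† gᵢ C, i.e. ρ(C† gᵢ C) = Mᵢ. -/
def IsFlowTableau {n : ℕ} (C : PMat n) (M : Fin (2 * n + 1) → GG n) : Prop :=
  ∀ i, PauliOp (M i).1 (M i).2.1 (M i).2.2 = Cᴴ * gens n i * C

/-- M is the Clifford tableau of C: row i presents C gᵢ C†, i.e. ρ(C gᵢ C†) = Mᵢ. -/
def IsCliffordTableau {n : ℕ} (C : PMat n) (M : Fin (2 * n + 1) → GG n) : Prop :=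
  ∀ i, PauliOp (M i).1 (M i).2.1 (M i).2.2 = C * gens n i * Cᴴ

/-- Row index 1,…,2n of a tableau, indexed by Fin n ⊕ Fin n. -/
def rowIdx (n : ℕ) : Fin n ⊕ Fin n → Fin (2 * n + 1)
  | .inl j => ⟨j.val + 1, by have := j.isLt; omega⟩
  | .inr j => ⟨n + j.val + 1, by have := j.isLt; omega⟩

/-- The phaseless 2n×2n block of a tableau over 𝔽₂: row i is (ξᵢ | ζᵢ). -/
def tabBlock {n : ℕ} (M : Fin (2 * n + 1) → GG n) :
    Matrix (Fin n ⊕ Fin n) (Fin n ⊕ Fin n) (ZMod 2) :=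
  fun i => Sum.elim (M (rowIdx n i)).2.1 (M (rowIdx n i)).2.2

/-- Ω = ((0,I),(I,0)). -/
def Ωblk (n : ℕ) : Matrix (Fin n ⊕ Fin n) (Fin n ⊕ Fin n) (ZMod 2) :=
  Matrix.fromBlocks 0 1 1 0

/-- The i-th bit (1 ≤ i ≤ 2n) of the phaseless part of ϱ ∈ Gₙ. -/
def bitOf {n : ℕ} (ϱ : GG n) (i : Fin (2 * n)) : ZMod 2 :=
  if h : i.val < n then ϱ.2.1 ⟨i.val, h⟩
  else ϱ.2.2 ⟨i.val - n, by have := i.isLt; omega⟩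

/-- The vector–tableau product ϱ ⊛ M := (ϱ₀·ε₀|0|0) ⊛ m_{i₁} ⊛ ⋯ ⊛ m_{i_k}
over the indices i ≥ 1 with ϱᵢ = 1, in increasing order. -/
def starVecMul {n : ℕ} (ϱ : GG n) (M : Fin (2 * n + 1) → GG n) : GG n :=
  (((List.finRange (2 * n)).filter (fun i => decide (bitOf ϱ i = 1))).map
    (fun i => M i.succ)).foldl gop (ϱ.1 * (M 0).1, 0, 0)

/-- The Pauli operator presented by an element of `GG n`. -/
noncomputable def pauliOf {n : ℕ} (p : GG n) : PMat n := PauliOp p.1 p.2.1 p.2.2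

theorem dotF2_add_left {n : ℕ} (a b c : Fin n → ZMod 2) :
    dotF2 (a + b) c = dotF2 a c + dotF2 b c := by
  simp [dotF2, add_mul, Finset.sum_add_distrib]

theorem dotF2_add_right {n : ℕ} (a b c : Fin n → ZMod 2) :
    dotF2 a (b + c) = dotF2 a b + dotF2 a c := by
  simp [dotF2, mul_add, Finset.sum_add_distrib]

@[simp]
theorem dotF2_zero_left {n : ℕ} (a : Fin n → ZMod 2) : dotF2 0 a = 0 := by
  simp [dotF2]

@[simp]
theorem dotF2_zero_right {n : ℕ} (a : Fin n → ZMod 2) : dotF2 a 0 = 0 := by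
  simp [dotF2]

@[simp]
theorem dotF2_eVec {n : ℕ} (a : Fin n → ZMod 2) (j : Fin n) : dotF2 a (eVec j) = a j := by
  simp [dotF2, eVec]

theorem I_pow_val_add (a b : ZMod 4) :
    Complex.I ^ (a + b).val = Complex.I ^ a.val * Complex.I ^ b.val := by
  rw [ZMod.val_add, ← pow_add, ← Complex.I_pow_eq_pow_mod]

theorem neg_one_pow_val_add (a b : ZMod 2) :
    (-1 : ℂ) ^ (a + b).val = (-1) ^ a.val * (-1) ^ b.val := by
  rw [ZMod.val_add, ← pow_add, ← neg_one_pow_eq_pow_mod_two]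

theorem I_pow_val_two_mul_lift24 (a : ZMod 2) :
    Complex.I ^ (2 * lift24 a).val = (-1) ^ a.val := by
  fin_cases a
  · change Complex.I ^ 0 = (-1) ^ 0
    simp
  · have h : (2 * lift24 1).val = 2 := by decide
    change Complex.I ^ (2 * lift24 1).val = (-1) ^ 1
    simp [h]

theorem I_pow_val_injective : Function.Injective fun a : ZMod 4 => Complex.I ^ a.val := by
  intro a b h
  have hI : Complex.I ≠ 1 := fun h => by simpa using congrArg Complex.im h
  have hI' : Complex.I ≠ -1 := fun h => by simpa using congrArg Complex.im h
  have hk : Complex.I ^ (a - b).val = 1 := by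
    have hb : Complex.I ^ b.val ≠ 0 := pow_ne_zero _ Complex.I_ne_zero
    refine mul_right_cancel₀ hb ?_
    rw [← I_pow_val_add, sub_add_cancel, one_mul]
    exact h
  refine sub_eq_zero.1 ?_
  generalize a - b = c at hk
  fin_cases c
  · rfl
  · exact absurd ((pow_one _).symm.trans hk) hI
  · change Complex.I ^ 2 = 1 at hk
    norm_num at hk
  · change Complex.I ^ 3 = 1 at hk
    rw [Complex.I_pow_three] at hk
    exact absurd (neg_eq_iff_eq_neg.1 hk) hI'

theorem neg_one_pow_val_injective :
    Function.Injective fun a : ZMod 2 => (-1 : ℂ) ^ a.val := by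
  intro a b h
  fin_cases a <;> fin_cases b
  · rfl
  · exact absurd (show (-1 : ℂ) ^ 0 = (-1) ^ 1 from h) (by norm_num)
  · exact absurd (show (-1 : ℂ) ^ 1 = (-1) ^ 0 from h) (by norm_num)
  · rfl

theorem pauliOf_gop {n : ℕ} (p q : GG n) : pauliOf (gop p q) = pauliOf p * pauliOf q := by
  ext u v
  rw [Matrix.mul_apply, Finset.sum_eq_single (v + q.2.1)]
  · simp only [pauliOf, PauliOp, gop, I_pow_val_add, I_pow_val_two_mul_lift24, dotF2_add_left,
      dotF2_add_right, neg_one_pow_val_add, if_true, add_assoc, add_comm q.2.1]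
    ring
  · intro w _ hw
    simp [pauliOf, PauliOp, hw]
  · simp

theorem pauliOf_injective {n : ℕ} : Function.Injective (pauliOf (n := n)) := by
  rintro ⟨a, ξ, ζ⟩ ⟨b, ξ', ζ'⟩ h
  have entry : ∀ u v, PauliOp a ξ ζ u v = PauliOp b ξ' ζ' u v := fun u v =>
    congrFun (congrFun h u) v
  have hξ : ξ = ξ' := by
    by_contra hne
    simpa [PauliOp, hne] using entry ξ 0
  subst hξ
  have hab : a = b := I_pow_val_injective (by simpa [PauliOp] using entry ξ 0)
  subst hab
  have hζ : ζ = ζ' := by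
    funext j
    exact neg_one_pow_val_injective (by simpa [PauliOp] using entry (eVec j + ξ) (eVec j))
  rw [hζ]

theorem pauliOf_one {n : ℕ} (a : ZMod 4) :
    pauliOf ((a, 0, 0) : GG n) = Complex.I ^ a.val • (1 : PMat n) := by
  ext u v
  simp [pauliOf, PauliOp, Matrix.one_apply]

theorem pauliOf_foldl_gop {n : ℕ} (L : List (GG n)) (a : GG n) :
    pauliOf (L.foldl gop a) = pauliOf a * (L.map pauliOf).prod := by
  induction L generalizing a with
  | nil => simp
  | cons x L ih => simp [ih, pauliOf_gop, mul_assoc]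

theorem gop_eq_add {n : ℕ} {p q : GG n} (h : dotF2 p.2.2 q.2.1 = 0) : gop p q = p + q := by
  ext <;> simp [gop, h, lift24]

/-- Without phase contributions, the `gop`-product of a list is its componentwise sum. -/
theorem foldl_gop_eq_add_sum {n : ℕ} (L : List (GG n)) (a : GG n)
    (h : (a :: L).Pairwise fun x y => dotF2 x.2.2 y.2.1 = 0) :
    L.foldl gop a = a + L.sum := by
  induction L generalizing a with
  | nil => simp
  | cons x L ih =>
    simp only [List.pairwise_cons, List.mem_cons, forall_eq_or_imp] at h
    obtain ⟨⟨hax, haL⟩, hxL, hL⟩ := h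
    rw [List.foldl_cons, gop_eq_add hax, ih, List.sum_cons, add_assoc]
    refine List.pairwise_cons.2 ⟨fun y hy => ?_, hL⟩
    simp [dotF2_add_left, haL y hy, hxL y hy]

theorem sum_map_filter_eq_sum_ite {α β : Type*} [AddCommMonoid β] (P : α → Prop)
    [DecidablePred P] (f : α → β) (L : List α) :
    ((L.filter fun i => decide (P i)).map f).sum = (L.map fun i => if P i then f i else 0).sum := by
  induction L with
  | nil => rfl
  | cons x L ih => by_cases hx : P x <;> simp [hx, ih]

theorem ite_eq_one_zmod_two (a : ZMod 2) : (if a = 1 then (1 : ZMod 2) else 0) = a := by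
  revert a
  decide

/-- The presentations of the generators `gens n i`. -/
def genTableau (n : ℕ) : Fin (2 * n + 1) → GG n :=
  Fin.cons (1, 0, 0) fun i =>
    (0, (if h : i.val < n then eVec ⟨i.val, h⟩ else 0),
      (if h : i.val < n then 0 else eVec ⟨i.val - n, by have := i.isLt; omega⟩))

theorem pauliOf_genTableau_succ {n : ℕ} (i : Fin (2 * n)) :
    pauliOf (genTableau n i.succ) = gens n i.succ := by
  by_cases h : i.val < n
  · simp [genTableau, gens, pauliOf, h]
  · simp [genTableau, gens, pauliOf, h]

theorem starVecMul_genTableau {n : ℕ} (p : GG n) : starVecMul p (genTableau n) = p := by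
  rw [starVecMul, foldl_gop_eq_add_sum]
  · rw [sum_map_filter_eq_sum_ite, ← Fin.sum_univ_def]
    refine Prod.ext ?_ (Prod.ext (funext fun j => ?_) (funext fun j => ?_))
    · simp [genTableau, Prod.fst_sum, apply_ite Prod.fst]
    · have hj := j.isLt
      simp only [Prod.snd_add, Prod.fst_add, Prod.snd_sum, Prod.fst_sum, zero_add,
        Finset.sum_apply]
      rw [Finset.sum_eq_single ⟨j.val, by omega⟩]
      · rw [← ite_eq_one_zmod_two (p.2.1 j)]
        split_ifs <;> simp_all [genTableau, bitOf, eVec, -Fin.succ_mk]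
      · intro i _ hi
        rw [ne_eq, Fin.ext_iff] at hi
        by_cases hin : i.val < n <;> split_ifs <;>
          simp [genTableau, eVec, hin, Fin.ext_iff, Ne.symm hi]
      · simp
    · have hj := j.isLt
      simp only [Prod.snd_add, Prod.snd_sum, zero_add, Finset.sum_apply]
      rw [Finset.sum_eq_single ⟨n + j.val, by omega⟩]
      · rw [← ite_eq_one_zmod_two (p.2.2 j)]
        split_ifs <;> simp_all [genTableau, bitOf, eVec, -Fin.succ_mk]
      · intro i _ hi
        rw [ne_eq, Fin.ext_iff] at hi
        by_cases hin : i.val < n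
        · split_ifs <;> simp [genTableau, hin]
        · have hij : ¬ j.val = i.val - n := by
            simp only at hi
            omega
          split_ifs <;> simp [genTableau, eVec, hin, Fin.ext_iff, hij]
      · simp
  · refine List.pairwise_cons.2 ⟨by simp, ?_⟩
    refine List.pairwise_map.2 (((List.pairwise_lt_finRange _).imp ?_).filter _)
    intro i j hij
    rw [Fin.lt_def] at hij
    by_cases hj : j.val < n
    · simp [genTableau, hij.trans hj]
    · simp [genTableau, hj]

theorem conj_list_prod {m : Type*} [Fintype m] [DecidableEq m] {C : Matrix m m ℂ}
    (h : C * Cᴴ = 1) (h' : Cᴴ * C = 1) (L : List (Matrix m m ℂ)) :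
    Cᴴ * L.prod * C = (L.map fun A => Cᴴ * A * C).prod := by
  induction L with
  | nil => simp [h']
  | cons A L ih =>
    rw [List.prod_cons, List.map_cons, List.prod_cons, ← ih]
    calc Cᴴ * (A * L.prod) * C = Cᴴ * A * 1 * L.prod * C := by simp only [mul_assoc, one_mul]
      _ = _ := by rw [← h]; simp only [mul_assoc]

/-- for a Clifford unitary C with flow tableau F(C) and an arbitrary
Pauli operator P with presentation p (i.e. P = PauliOp p), the presentation q of the
pullback C† P C satisfies q = p ⊛ F(C). -/
theorem stmt14 (n : ℕ) (hn : 1 ≤ n) (C : PMat n) (hC : IsCliffordUnitary C)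
    (M : Fin (2 * n + 1) → GG n) (hM : IsFlowTableau C M)
    (p q : GG n)
    (hq : PauliOp q.1 q.2.1 q.2.2 = Cᴴ * PauliOp p.1 p.2.1 p.2.2 * C) :
    q = starVecMul p M := by
  obtain ⟨h, h', -⟩ := hC
  have hM0 : M 0 = (1, 0, 0) := by
    apply pauliOf_injective
    rw [pauliOf_one]
    refine (hM 0).trans ?_
    simp [gens, h', ZMod.val_one'']
  apply pauliOf_injective
  refine hq.trans ?_
  change Cᴴ * pauliOf p * C = _
  conv_lhs => rw [← starVecMul_genTableau p]
  have hrow : ∀ i : Fin (2 * n),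
      pauliOf (M i.succ) = Cᴴ * pauliOf (genTableau n i.succ) * C := fun i =>
    (hM i.succ).trans (by rw [pauliOf_genTableau_succ])
  have hG0 : genTableau n 0 = (1, 0, 0) := rfl
  simp only [starVecMul, pauliOf_foldl_gop, hM0, hG0, pauliOf_one, Matrix.smul_mul,
    Matrix.mul_smul, one_mul, conj_list_prod h h', List.map_map, Function.comp_def, hrow]
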